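/- Let n ≥ 1 and let H ≤ U(n) be the subgroup of unitary matrices with all entries real (i.e. O(n) embedded in U(n)). Then the fundamental group of the quotient topological space U(n)/H (the coset space with the quotient topology) is isomorphic to ℤ: π₁(U(n)/O(n)) ≅ ℤ. Equivalently, the Lagrangian Grassmannian L(n) ≅ U(n)/O(n) has fundamental group ℤ. -/

import Mathlib

open Matrix

/-- The subgroup `O(n) ≤ U(n)`: unitary matrices with all entries real. -/
def realOrthogonalSubgroup (n : ℕ) : Subgroup (Matrix.unitaryGroup (Fin n) ℂ) where
  carrier := {U | ∀ i j, ((U : Matrix (Fin n) (Fin n) ℂ) i j).im = 0}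
  one_mem' := by
    intro i j
    by_cases h : i = j <;> simp [Matrix.one_apply, h]
  mul_mem' := by
    intro U V hU hV i j
    rw [Matrix.UnitaryGroup.mul_apply, Matrix.mul_apply, Complex.im_sum]
    exact Finset.sum_eq_zero fun k _ => by rw [Complex.mul_im, hU i k, hV k j]; ring
  inv_mem' := by
    intro U hU i j
    show (((U⁻¹ : Matrix.unitaryGroup (Fin n) ℂ) : Matrix (Fin n) (Fin n) ℂ) i j).im = 0
    have : ((U⁻¹ : Matrix.unitaryGroup (Fin n) ℂ) : Matrix (Fin n) (Fin n) ℂ) =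
        star (U : Matrix (Fin n) (Fin n) ℂ) := rfl
    rw [this]
    simp only [Matrix.star_apply, Complex.star_def, Complex.conj_im, hU j i, neg_zero]



/-! ### Transport classes along maps from simply connected spaces -/

section TransportCalculus

open unitInterval

variable {S : Type*} [TopologicalSpace S]

/-- The class of the image under `f` of any path from `x` to `y` in a simply connected space. -/
noncomputable def tr {X : Type*} [TopologicalSpace X] [SimplyConnectedSpace X] (f : C(X, S))
    (x y : X) {a b : S} (hx : f x = a) (hy : f y = b) : Path.Homotopic.Quotient a b :=
  ((Path.Homotopic.Quotient.mk (PathConnectedSpace.somePath x y)).map f).cast hx.symm hy.symm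

theorem tr_eq_mk {X : Type*} [TopologicalSpace X] [SimplyConnectedSpace X] (f : C(X, S))
    {x y : X} {a b : S} (hx : f x = a) (hy : f y = b) (p : Path x y) (q : Path a b)
    (h : ∀ t, q t = f (p t)) : tr f x y hx hy = .mk q := by
  subst hx hy
  unfold tr
  rw [Path.Homotopic.Quotient.cast_rfl_rfl,
    Subsingleton.elim (Path.Homotopic.Quotient.mk (PathConnectedSpace.somePath x y)) (.mk p),
    ← Path.Homotopic.Quotient.mk_map]
  congr 1
  ext t
  exact (h t).symm

theorem tr_trans {X : Type*} [TopologicalSpace X] [SimplyConnectedSpace X] (f : C(X, S))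
    (x y z : X) {a b c : S} (hx : f x = a) (hy : f y = b) (hz : f z = c) :
    (tr f x y hx hy).trans (tr f y z hy hz) = tr f x z hx hz := by
  subst hx hy hz
  let p := PathConnectedSpace.somePath x y
  let q := PathConnectedSpace.somePath y z
  rw [tr_eq_mk f rfl rfl p (p.map f.continuous) (fun _ => rfl),
    tr_eq_mk f rfl rfl q (q.map f.continuous) (fun _ => rfl),
    tr_eq_mk f rfl rfl (p.trans q) ((p.trans q).map f.continuous) (fun _ => rfl),
    Path.map_trans, Path.Homotopic.Quotient.mk_trans]

theorem tr_self {X : Type*} [TopologicalSpace X] [SimplyConnectedSpace X] (f : C(X, S))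
    (x : X) {a : S} (hx : f x = a) : tr f x x hx hx = .refl a := by
  subst hx
  exact tr_eq_mk f rfl rfl (Path.refl x) (Path.refl _) (fun _ => rfl)

/-- If `f ∘ j = g ∘ k` on a path connected space, then the classes agree. -/
theorem tr_congr {X Y Z : Type*} [TopologicalSpace X] [SimplyConnectedSpace X]
    [TopologicalSpace Y] [SimplyConnectedSpace Y] [TopologicalSpace Z] [PathConnectedSpace Z]
    (f : C(X, S)) (g : C(Y, S)) (j : C(Z, X)) (k : C(Z, Y)) (hfg : ∀ t, f (j t) = g (k t))
    (z w : Z) {x x' : X} {y y' : Y} (hx : j z = x) (hx' : j w = x') (hy : k z = y) (hy' : k w = y')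
    {a b : S} (h1 : f x = a) (h2 : f x' = b) (h3 : g y = a) (h4 : g y' = b) :
    tr f x x' h1 h2 = tr g y y' h3 h4 := by
  subst hx hx' hy hy' h1 h2
  let p := PathConnectedSpace.somePath z w
  rw [tr_eq_mk f rfl rfl (p.map j.continuous) ((p.map j.continuous).map f.continuous)
    (fun _ => rfl)]
  symm
  exact tr_eq_mk g _ _ (p.map k.continuous) _ (fun t => hfg _)

theorem tr_const {X : Type*} [TopologicalSpace X] [SimplyConnectedSpace X]
    {Z : Type*} [TopologicalSpace Z] [PathConnectedSpace Z] (f : C(X, S)) (j : C(Z, X)) {a : S}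
    (h : ∀ t, f (j t) = a) (z w : Z) {x y : X} (hx : j z = x) (hy : j w = y)
    (h1 : f x = a) (h2 : f y = a) : tr f x y h1 h2 = .refl a := by
  subst hx hy
  let p := PathConnectedSpace.somePath z w
  exact tr_eq_mk f _ _ (p.map j.continuous) (Path.refl a) (fun t => (h _).symm)

instance contractible_unitInterval_inst : ContractibleSpace I :=
  (convex_Icc (0 : ℝ) 1).contractibleSpace ⟨0, by simp⟩

theorem tr_unitInterval {a b : S} (p : Path a b) :
    tr p.toContinuousMap 0 1 p.source p.target = Path.Homotopic.Quotient.mk p :=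
  tr_eq_mk p.toContinuousMap _ _ ⟨ContinuousMap.id _, rfl, rfl⟩ p (fun _ => rfl)

end TransportCalculus


/-! ### Symmetric unitary matrices, real symmetric matrices, the Cayley transform -/

section CayleyTransform

open Matrix Complex
open scoped ComplexOrder

/-- Symmetric unitary matrices. -/
abbrev SymU (n : ℕ) : Type :=
  {A : Matrix (Fin n) (Fin n) ℂ // Aᵀ = A ∧ A * Aᴴ = 1}

/-- Real symmetric matrices. -/
abbrev SymR (n : ℕ) : Type :=
  {K : Matrix (Fin n) (Fin n) ℝ // Kᵀ = K}

/-- Real orthogonal matrices. -/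
abbrev OrthR (n : ℕ) : Type :=
  {o : Matrix (Fin n) (Fin n) ℝ // o * oᵀ = 1}

/-- Complexification of a real matrix. -/
noncomputable abbrev cx {n : ℕ} : Matrix (Fin n) (Fin n) ℝ →+* Matrix (Fin n) (Fin n) ℂ :=
  Complex.ofRealHom.mapMatrix

variable {n : ℕ}

theorem cx_transpose (M : Matrix (Fin n) (Fin n) ℝ) : cx Mᵀ = (cx M)ᵀ := rfl

theorem cx_conjTranspose (M : Matrix (Fin n) (Fin n) ℝ) : (cx M)ᴴ = (cx M)ᵀ := by
  ext i j; simp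

theorem cx_injective : Function.Injective (cx (n := n)) := by
  intro A B h
  ext i j
  have := congrFun (congrFun h i) j
  simpa using this

theorem continuous_cx : Continuous (cx (n := n)) :=
  continuous_id.matrix_map Complex.continuous_ofReal

instance contractible_symR : ContractibleSpace (SymR n) := by
  have : Convex ℝ {K : Matrix (Fin n) (Fin n) ℝ | Kᵀ = K} := by
    intro A hA B hB a b _ _ _
    simp only [Set.mem_ofPred_eq] at hA hB ⊢
    rw [transpose_add, transpose_smul, transpose_smul, hA, hB]
  exact this.contractibleSpace ⟨0, by simp⟩

/-- The denominator in the Cayley transform. -/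
noncomputable def cden (K : SymR n) : Matrix (Fin n) (Fin n) ℂ := cx K.1 + (I : ℂ) • 1

/-- The numerator in the Cayley transform. -/
noncomputable def cnum (K : SymR n) : Matrix (Fin n) (Fin n) ℂ := cx K.1 - (I : ℂ) • 1

theorem cden_transpose (K : SymR n) : (cden K)ᵀ = cden K := by
  simp only [cden, transpose_add, transpose_smul, transpose_one, ← cx_transpose, K.2]

theorem cnum_transpose (K : SymR n) : (cnum K)ᵀ = cnum K := by
  simp only [cnum, transpose_sub, transpose_smul, transpose_one, ← cx_transpose, K.2]

theorem cden_conjTranspose (K : SymR n) : (cden K)ᴴ = cnum K := by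
  simp only [cden, cnum, conjTranspose_add, conjTranspose_smul, conjTranspose_one,
    cx_conjTranspose, ← cx_transpose, K.2]
  simp [sub_eq_add_neg]

theorem cnum_conjTranspose (K : SymR n) : (cnum K)ᴴ = cden K := by
  rw [← cden_conjTranspose, conjTranspose_conjTranspose]

theorem cden_mul_cnum (K : SymR n) : cden K * cnum K = cx K.1 * cx K.1 + 1 := by
  simp only [cden, cnum, add_mul, mul_sub, smul_mul_assoc, one_mul, mul_smul_comm, mul_one,
    smul_add, smul_sub, smul_smul, I_mul_I, neg_smul, one_smul]
  abel

theorem cnum_mul_cden (K : SymR n) : cnum K * cden K = cx K.1 * cx K.1 + 1 := by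
  simp only [cden, cnum, mul_add, sub_mul, smul_mul_assoc, one_mul, mul_smul_comm, mul_one,
    smul_add, smul_sub, smul_smul, I_mul_I, neg_smul, one_smul]
  abel

theorem isUnit_one_add (K : SymR n) : IsUnit (cx K.1 * cx K.1 + 1) := by
  have h : (cx K.1 * cx K.1 + 1) = 1 + (cx K.1)ᴴ * cx K.1 := by
    rw [cx_conjTranspose, ← cx_transpose, K.2, add_comm]
  rw [h]
  exact (Matrix.PosDef.one.add_posSemidef (posSemidef_conjTranspose_mul_self _)).isUnit

theorem isUnit_cden (K : SymR n) : IsUnit (cden K).det := by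
  have := (Matrix.isUnit_iff_isUnit_det _).1 (isUnit_one_add K)
  rw [← cden_mul_cnum, det_mul] at this
  exact isUnit_of_mul_isUnit_left this

theorem isUnit_cnum (K : SymR n) : IsUnit (cnum K).det := by
  have := (Matrix.isUnit_iff_isUnit_det _).1 (isUnit_one_add K)
  rw [← cden_mul_cnum, det_mul] at this
  exact isUnit_of_mul_isUnit_right this

/-- The Cayley transform, as a matrix. -/
noncomputable def cayM (z : Circle) (K : SymR n) : Matrix (Fin n) (Fin n) ℂ :=
  (z : ℂ) • (cnum K * (cden K)⁻¹)

theorem cayM_mul (z : Circle) (K : SymR n) : cayM z K * cden K = (z : ℂ) • cnum K := by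
  rw [cayM, smul_mul_assoc, nonsing_inv_mul_cancel_right _ _ (isUnit_cden K)]

theorem eq_cayM {z : Circle} {K : SymR n} {A : Matrix (Fin n) (Fin n) ℂ}
    (h : A * cden K = (z : ℂ) • cnum K) : A = cayM z K := by
  rw [cayM, ← smul_mul_assoc, ← h, mul_nonsing_inv_cancel_right _ _ (isUnit_cden K)]

theorem cayM_transpose (z : Circle) (K : SymR n) : (cayM z K)ᵀ = cayM z K := by
  rw [cayM, transpose_smul, transpose_mul, transpose_nonsing_inv, cden_transpose, cnum_transpose]
  congr 1
  have h : cden K * cnum K = cnum K * cden K := by rw [cden_mul_cnum, cnum_mul_cden]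
  calc (cden K)⁻¹ * cnum K = (cden K)⁻¹ * (cnum K * cden K) * (cden K)⁻¹ := by
        rw [mul_assoc, mul_nonsing_inv_cancel_right _ _ (isUnit_cden K)]
    _ = cnum K * (cden K)⁻¹ := by
        rw [← h, nonsing_inv_mul_cancel_left _ _ (isUnit_cden K)]

theorem circle_mul_star (z : Circle) : (z : ℂ) * star (z : ℂ) = 1 := by
  rw [Complex.star_def, Complex.mul_conj, Complex.normSq_eq_norm_sq, Circle.norm_coe]; simp

theorem cayM_unitary (z : Circle) (K : SymR n) : cayM z K * (cayM z K)ᴴ = 1 := by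
  rw [cayM, conjTranspose_smul, conjTranspose_mul, conjTranspose_nonsing_inv,
    cden_conjTranspose, cnum_conjTranspose, smul_mul_smul_comm, circle_mul_star, one_smul]
  have h : cden K * cnum K = cnum K * cden K := by rw [cden_mul_cnum, cnum_mul_cden]
  have h2 : (cden K)⁻¹ * (cnum K)⁻¹ = (cnum K)⁻¹ * (cden K)⁻¹ := by
    rw [← Matrix.mul_inv_rev, ← Matrix.mul_inv_rev, h]
  calc cnum K * (cden K)⁻¹ * ((cnum K)⁻¹ * cden K)
      = cnum K * ((cden K)⁻¹ * (cnum K)⁻¹) * cden K := by simp only [mul_assoc]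
    _ = cnum K * ((cnum K)⁻¹ * ((cden K)⁻¹ * cden K)) := by rw [h2]; simp only [mul_assoc]
    _ = 1 := by
      rw [nonsing_inv_mul _ (isUnit_cden K), mul_one, mul_nonsing_inv _ (isUnit_cnum K)]

theorem continuous_cden : Continuous (cden (n := n)) :=
  (continuous_cx.comp continuous_subtype_val).add continuous_const

theorem continuous_cnum : Continuous (cnum (n := n)) :=
  (continuous_cx.comp continuous_subtype_val).sub continuous_const

theorem continuousAt_matInv {X : Type*} [TopologicalSpace X]
    {f : X → Matrix (Fin n) (Fin n) ℂ} {x : X} (hf : ContinuousAt f x) (h : IsUnit (f x).det) :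
    ContinuousAt (fun y => (f y)⁻¹) x := by
  have h1 : ContinuousAt (fun A : Matrix (Fin n) (Fin n) ℂ => A⁻¹) (f x) := by
    refine continuousAt_matrix_inv _ ?_
    obtain ⟨u, hu⟩ := h
    rw [← hu]
    exact NormedRing.inverse_continuousAt u
  exact ContinuousAt.comp (f := f) h1 hf

/-- The Cayley transform `K ↦ z (K - i) (K + i)⁻¹`. -/
noncomputable def cay (z : Circle) : C(SymR n, SymU n) where
  toFun K := ⟨cayM z K, cayM_transpose z K, cayM_unitary z K⟩
  continuous_toFun := by
    refine Continuous.subtype_mk ?_ _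
    change Continuous fun K : SymR n => (z : ℂ) • (cnum K * (cden K)⁻¹)
    refine ((continuous_cnum (n := n)).mul ?_).const_smul (z : ℂ)
    rw [continuous_iff_continuousAt]
    exact fun K => continuousAt_matInv continuous_cden.continuousAt (isUnit_cden K)

theorem cay_mul (z : Circle) (K : SymR n) : (cay z K).1 * cden K = (z : ℂ) • cnum K :=
  cayM_mul z K

theorem eq_cay {z : Circle} {K : SymR n} {A : SymU n}
    (h : A.1 * cden K = (z : ℂ) • cnum K) : A = cay z K :=
  Subtype.ext (eq_cayM h)

end CayleyTransform


/-! ### The inverse Cayley transform, and the cover by its domains -/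

section InverseCayley

open Matrix Complex
open scoped ComplexOrder

variable {n : ℕ}

/-- The domain of the inverse Cayley transform. -/
def Vz (z : Circle) : Set (SymU n) := {A | IsUnit ((z : ℂ) • (1 : Matrix (Fin n) (Fin n) ℂ) - A.1).det}

theorem isOpen_Vz (z : Circle) : IsOpen (Vz (n := n) z) := by
  have : Continuous fun A : SymU n => ((z : ℂ) • (1 : Matrix (Fin n) (Fin n) ℂ) - A.1).det :=
    (continuous_const.sub continuous_subtype_val).matrix_det
  have h : Vz (n := n) z = (fun A : SymU n =>
      ((z : ℂ) • (1 : Matrix (Fin n) (Fin n) ℂ) - A.1).det) ⁻¹' {0}ᶜ := by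
    ext A; simp [Vz, isUnit_iff_ne_zero]
  rw [h]
  exact isOpen_compl_singleton.preimage this

instance infinite_circle_inst : Infinite Circle := by
  have : Infinite (Set.Ioc (-Real.pi) Real.pi) :=
    (Set.Ioc_infinite (by linarith [Real.pi_pos])).to_subtype
  exact Circle.argEquiv.infinite_iff.2 this

theorem exists_mem_Vz (A : SymU n) : ∃ z : Circle, A ∈ Vz z := by
  by_contra! h
  have h2 : ∀ z : Circle, A.1.charpoly.IsRoot (z : ℂ) := by
    intro z
    have := h z
    simp only [Vz, Set.mem_ofPred_eq, isUnit_iff_ne_zero, not_not] at this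
    rw [Polynomial.IsRoot, Matrix.eval_charpoly, ← this]
    congr 2
    simp [Matrix.smul_one_eq_diagonal]
  have h3 : A.1.charpoly = 0 := by
    refine Polynomial.eq_zero_of_infinite_isRoot _ ?_
    refine (Set.infinite_range_of_injective (f := fun z : Circle => (z : ℂ)) Circle.coe_injective).mono ?_
    rintro _ ⟨z, rfl⟩
    exact h2 z
  exact A.1.charpoly_monic.ne_zero h3

/-- The inverse Cayley transform (complex form). -/
noncomputable def kayC (z : Circle) (A : SymU n) : Matrix (Fin n) (Fin n) ℂ :=
  (I : ℂ) • ((2 * z : ℂ) • ((z : ℂ) • (1 : Matrix (Fin n) (Fin n) ℂ) - A.1)⁻¹ - 1)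

theorem kayC_transpose (z : Circle) (A : SymU n) : (kayC z A)ᵀ = kayC z A := by
  simp only [kayC, transpose_smul, transpose_sub, transpose_nonsing_inv, transpose_one, A.2.1]

theorem kayC_conjTranspose (z : Circle) (A : SymU n) (hA : A ∈ Vz z) :
    (kayC z A)ᴴ = kayC z A := by
  have hz : star (z : ℂ) * (z : ℂ) = 1 := by rw [mul_comm]; exact circle_mul_star z
  have hA' : A.1ᴴ * A.1 = 1 := mul_eq_one_comm.1 A.2.2
  set C := (z : ℂ) • (1 : Matrix (Fin n) (Fin n) ℂ) - A.1 with hC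
  have hCu : IsUnit C.det := hA
  have hCu' : IsUnit (Cᴴ).det := by rw [det_conjTranspose]; exact hCu.star
  have h0 : (z : ℂ) • Cᴴ + star (z : ℂ) • C = Cᴴ * C := by
    simp only [hC, conjTranspose_sub, conjTranspose_smul, conjTranspose_one, sub_mul, mul_sub,
      smul_mul_assoc, mul_smul_comm, one_mul, mul_one, hA', smul_sub, smul_smul, hz,
      circle_mul_star, one_smul]
    abel
  have h1 : (z : ℂ) • C⁻¹ + star (z : ℂ) • (Cᴴ)⁻¹ = 1 := by
    have h2 : (Cᴴ)⁻¹ * ((z : ℂ) • Cᴴ + star (z : ℂ) • C) * C⁻¹ = (Cᴴ)⁻¹ * (Cᴴ * C) * C⁻¹ := by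
      rw [h0]
    rw [nonsing_inv_mul_cancel_left _ _ hCu', mul_nonsing_inv _ hCu, mul_add, add_mul,
      mul_smul_comm, mul_smul_comm, smul_mul_assoc, smul_mul_assoc, nonsing_inv_mul _ hCu',
      one_mul, mul_nonsing_inv_cancel_right _ _ hCu] at h2
    exact h2
  have h3 : star (z : ℂ) • (Cᴴ)⁻¹ = 1 - (z : ℂ) • C⁻¹ := eq_sub_of_add_eq' h1
  simp only [kayC, ← hC, conjTranspose_smul, conjTranspose_sub, conjTranspose_nonsing_inv,
    conjTranspose_one, mul_smul, h3]
  simp [smul_sub, two_smul]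
  abel

/-- The inverse Cayley transform. -/
noncomputable def kay (z : Circle) (A : SymU n) : SymR n :=
  ⟨(kayC z A).map Complex.re, by rw [← transpose_map, kayC_transpose]⟩

theorem cx_kay (z : Circle) (A : SymU n) (hA : A ∈ Vz z) : cx (kay z A).1 = kayC z A := by
  ext i j
  have h1 := congrFun (congrFun (kayC_conjTranspose z A hA) i) j
  have h2 := congrFun (congrFun (kayC_transpose z A) i) j
  rw [conjTranspose_apply] at h1
  rw [transpose_apply] at h2
  rw [h2] at h1
  change (((kayC z A i j).re : ℝ) : ℂ) = _
  exact Complex.conj_eq_iff_re.1 h1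

theorem cay_kay (z : Circle) (A : SymU n) (hA : A ∈ Vz z) : cay z (kay z A) = A := by
  symm
  apply eq_cay
  have hC : ((z : ℂ) • (1 : Matrix (Fin n) (Fin n) ℂ) - A.1) *
    ((z : ℂ) • (1 : Matrix (Fin n) (Fin n) ℂ) - A.1)⁻¹ = 1 := mul_nonsing_inv _ hA
  rw [cden, cnum, cx_kay z A hA, kayC]
  set B := ((z : ℂ) • (1 : Matrix (Fin n) (Fin n) ℂ) - A.1)⁻¹
  rw [sub_mul, smul_mul_assoc, one_mul] at hC
  have hAB : A.1 * B = (z : ℂ) • B - 1 := by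
    have h := sub_eq_iff_eq_add.1 hC
    rw [h]; abel
  rw [smul_sub, sub_add_cancel, mul_smul_comm, mul_smul_comm, hAB]
  module

theorem continuousOn_kay (z : Circle) : ContinuousOn (kay (n := n) z) (Vz z) := by
  intro A hA
  apply ContinuousAt.continuousWithinAt
  suffices h : ContinuousAt (fun A : SymU n => (kayC z A).map Complex.re) A from
    (Topology.IsInducing.subtypeVal.continuousAt_iff (f := kay z)).2 h
  refine ContinuousAt.comp (g := fun M : Matrix (Fin n) (Fin n) ℂ => M.map Complex.re)
    (continuous_id.matrix_map Complex.continuous_re).continuousAt ?_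
  refine ContinuousAt.const_smul ?_ (I : ℂ)
  refine ContinuousAt.sub (ContinuousAt.const_smul ?_ (2 * z : ℂ)) continuousAt_const
  exact continuousAt_matInv (continuous_const.sub continuous_subtype_val).continuousAt hA

end InverseCayley


/-! ### Diagonal matrices and conjugation by orthogonal matrices -/

section DiagonalAndConjugation

open Matrix Complex
open scoped ComplexOrder

variable {n : ℕ}

/-- Diagonal symmetric unitary matrices. -/
noncomputable def dS (c : Fin n → Circle) : SymU n :=
  ⟨diagonal fun j => (c j : ℂ), diagonal_transpose _, by
    rw [diagonal_conjTranspose, diagonal_mul_diagonal, ← diagonal_one]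
    congr 1
    ext j
    exact circle_mul_star (c j)⟩

theorem dS_injective : Function.Injective (dS (n := n)) := by
  intro c d h
  have h1 := diagonal_injective (congrArg Subtype.val h)
  ext j
  exact congrFun h1 j

theorem continuous_dS : Continuous (dS (n := n)) := by
  refine Continuous.subtype_mk ?_ _
  exact Continuous.matrix_diagonal
    (continuous_pi fun j => (show Continuous fun z : Circle => (z : ℂ) from continuous_subtype_val).comp (continuous_apply j))

/-- The exponential parametrization of diagonal unitary matrices. -/
noncomputable def Dexp : C(Fin n → ℝ, SymU n) where
  toFun θ := dS fun j => Circle.exp (θ j)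
  continuous_toFun := continuous_dS.comp
    (continuous_pi fun j => Circle.exp.continuous.comp (continuous_apply j))

/-- Real diagonal matrices. -/
def diagR : C(Fin n → ℝ, SymR n) where
  toFun κ := ⟨diagonal κ, diagonal_transpose _⟩
  continuous_toFun := Continuous.subtype_mk continuous_id.matrix_diagonal _

/-- The argument of `(κ - i) / (κ + i)`. -/
noncomputable def argc (κ : ℝ) : ℝ := 2 * Real.arctan κ - Real.pi

theorem continuous_argc : Continuous argc :=
  (Real.continuous_arctan.const_mul 2).sub continuous_const

theorem exp_argc (κ : ℝ) : (Circle.exp (argc κ) : ℂ) * (κ + I) = κ - I := by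
  have h1 : Complex.exp ((Real.arctan κ : ℝ) * I) * (Real.sqrt (1 + κ ^ 2) : ℝ) = 1 + κ * I := by
    rw [Complex.exp_mul_I, ← Complex.ofReal_cos, ← Complex.ofReal_sin, Real.cos_arctan,
      Real.sin_arctan]
    have h : (Real.sqrt (1 + κ ^ 2) : ℂ) ≠ 0 := by
      exact_mod_cast (Real.sqrt_pos.2 (by positivity)).ne'
    push_cast
    field_simp
  have h2 : ((Real.sqrt (1 + κ ^ 2) : ℝ) : ℂ) ^ 2 = 1 + κ ^ 2 := by
    rw [← Complex.ofReal_pow, Real.sq_sqrt (by positivity)]; push_cast; rfl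
  have h3 : (Circle.exp (argc κ) : ℂ) = - Complex.exp ((Real.arctan κ : ℝ) * I) ^ 2 := by
    rw [Circle.coe_exp, argc, ← Complex.exp_nat_mul]
    push_cast
    rw [sub_mul, Complex.exp_sub, Complex.exp_pi_mul_I]
    ring_nf
  have h4 : (1 + κ ^ 2 : ℂ) ≠ 0 := by
    exact_mod_cast (show (0:ℝ) < 1 + κ ^ 2 by positivity).ne'
  rw [h3]
  apply mul_right_cancel₀ h4
  rw [← h2]
  have h5 : -Complex.exp ((Real.arctan κ : ℝ) * I) ^ 2 * (κ + I) * (Real.sqrt (1 + κ ^ 2) : ℝ) ^ 2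
     = - (1 + κ * I) ^ 2 * (κ + I) := by rw [← h1]; ring
  rw [h5, h2]
  linear_combination (-κ ^ 3 - κ ^ 2 * I - 2 * κ) * I_sq

theorem cden_diagR (κ : Fin n → ℝ) : cden (diagR κ) = diagonal fun j => ((κ j : ℂ) + I) := by
  ext i j
  by_cases h : i = j
  · subst h; simp [cden, diagR]
  · simp [cden, diagR, h]

theorem cnum_diagR (κ : Fin n → ℝ) : cnum (diagR κ) = diagonal fun j => ((κ j : ℂ) - I) := by
  ext i j
  by_cases h : i = j
  · subst h; simp [cnum, diagR]
  · simp [cnum, diagR, h]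

theorem cay_diagR (z : Circle) (κ : Fin n → ℝ) :
    cay z (diagR κ) = dS fun j => z * Circle.exp (argc (κ j)) := by
  symm
  apply eq_cay
  rw [cden_diagR, cnum_diagR, dS, diagonal_mul_diagonal, ← diagonal_smul]
  congr 1
  ext j
  simp only [Circle.coe_mul, mul_assoc, exp_argc]
  rfl

theorem Dexp_eq_cay_iff (z : Circle) (θ κ : Fin n → ℝ) :
    Dexp θ = cay z (diagR κ) ↔ ∀ j, Circle.exp (θ j) = z * Circle.exp (argc (κ j)) := by
  rw [cay_diagR]
  exact dS_injective.eq_iff.trans funext_iff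

/-- Conjugation on real symmetric matrices. -/
def conjR (o : OrthR n) (K : SymR n) : SymR n :=
  ⟨o.1 * K.1 * o.1ᵀ, by
    rw [transpose_mul, transpose_mul, K.2, transpose_transpose, mul_assoc]⟩

theorem OrthR.mul_tr (o : OrthR n) : o.1ᵀ * o.1 = 1 := mul_eq_one_comm.1 o.2

theorem OrthR.cx_mul_tr (o : OrthR n) : (cx o.1)ᵀ * cx o.1 = 1 := by
  rw [← cx_transpose, ← map_mul, OrthR.mul_tr, map_one]

theorem OrthR.cx_tr_mul (o : OrthR n) : cx o.1 * (cx o.1)ᵀ = 1 := by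
  rw [← cx_transpose, ← map_mul, o.2, map_one]

/-- Conjugation on symmetric unitary matrices. -/
noncomputable def conjS (o : OrthR n) (A : SymU n) : SymU n :=
  ⟨cx o.1 * A.1 * (cx o.1)ᵀ, by
    rw [transpose_mul, transpose_mul, A.2.1, transpose_transpose, mul_assoc], by
    rw [← cx_conjTranspose, conjTranspose_mul, conjTranspose_mul, conjTranspose_conjTranspose]
    rw [cx_conjTranspose]
    calc cx o.1 * A.1 * (cx o.1)ᵀ * (cx o.1 * (A.1ᴴ * (cx o.1)ᵀ))
        = cx o.1 * A.1 * ((cx o.1)ᵀ * cx o.1) * (A.1ᴴ * (cx o.1)ᵀ) := by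
          simp only [mul_assoc]
      _ = cx o.1 * (A.1 * A.1ᴴ) * (cx o.1)ᵀ := by
          rw [OrthR.cx_mul_tr, mul_one]; simp only [mul_assoc]
      _ = 1 := by rw [A.2.2, mul_one, OrthR.cx_tr_mul]⟩

/-- The inverse orthogonal matrix. -/
def OrthR.inv (o : OrthR n) : OrthR n := ⟨o.1ᵀ, by rw [transpose_transpose, o.mul_tr]⟩

theorem conjR_inv (o : OrthR n) (K : SymR n) : conjR o (conjR o.inv K) = K := by
  apply Subtype.ext
  change o.1 * (o.1ᵀ * K.1 * o.1ᵀᵀ) * o.1ᵀ = K.1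
  rw [transpose_transpose]
  calc o.1 * (o.1ᵀ * K.1 * o.1) * o.1ᵀ = (o.1 * o.1ᵀ) * K.1 * (o.1 * o.1ᵀ) := by
        simp only [mul_assoc]
    _ = K.1 := by rw [o.2, one_mul, mul_one]

theorem conjS_injective (o : OrthR n) : Function.Injective (conjS o) := by
  intro A B h
  have h1 : cx o.1 * A.1 * (cx o.1)ᵀ = cx o.1 * B.1 * (cx o.1)ᵀ := congrArg Subtype.val h
  have h2 := congrArg (fun M => (cx o.1)ᵀ * M * cx o.1) h1
  have h3 : ∀ M : Matrix (Fin n) (Fin n) ℂ,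
      (cx o.1)ᵀ * (cx o.1 * M * (cx o.1)ᵀ) * cx o.1 = M := by
    intro M
    calc (cx o.1)ᵀ * (cx o.1 * M * (cx o.1)ᵀ) * cx o.1
        = ((cx o.1)ᵀ * cx o.1) * M * ((cx o.1)ᵀ * cx o.1) := by simp only [mul_assoc]
      _ = M := by rw [OrthR.cx_mul_tr, one_mul, mul_one]
  simp only [h3] at h2
  exact Subtype.ext h2

theorem cay_conj (z : Circle) (o : OrthR n) (K : SymR n) :
    cay z (conjR o K) = conjS o (cay z K) := by
  symm
  apply eq_cay
  have h1 : cden (conjR o K) = cx o.1 * cden K * (cx o.1)ᵀ := by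
    simp only [cden, conjR, mul_add, add_mul, map_mul, cx_transpose, mul_smul_comm,
      smul_mul_assoc, mul_one, OrthR.cx_tr_mul]
  have h2 : cnum (conjR o K) = cx o.1 * cnum K * (cx o.1)ᵀ := by
    simp only [cnum, conjR, mul_sub, sub_mul, map_mul, cx_transpose, mul_smul_comm,
      smul_mul_assoc, mul_one, OrthR.cx_tr_mul]
  rw [h1, h2]
  change cx o.1 * (cay z K).1 * (cx o.1)ᵀ * _ = _
  calc cx o.1 * (cay z K).1 * (cx o.1)ᵀ * (cx o.1 * cden K * (cx o.1)ᵀ)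
      = cx o.1 * (cay z K).1 * ((cx o.1)ᵀ * cx o.1) * (cden K * (cx o.1)ᵀ) := by
        simp only [mul_assoc]
    _ = cx o.1 * ((cay z K).1 * cden K) * (cx o.1)ᵀ := by
        rw [OrthR.cx_mul_tr, mul_one]; simp only [mul_assoc]
    _ = (z : ℂ) • (cx o.1 * cnum K * (cx o.1)ᵀ) := by
        rw [cay_mul, mul_smul_comm, smul_mul_assoc]

theorem continuous_conjR : Continuous fun p : OrthR n × SymR n => conjR p.1 p.2 := by
  refine Continuous.subtype_mk ?_ _
  have h1 : Continuous fun p : OrthR n × SymR n => p.1.1 :=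
    continuous_subtype_val.comp continuous_fst
  have h2 : Continuous fun p : OrthR n × SymR n => p.2.1 :=
    continuous_subtype_val.comp continuous_snd
  exact (h1.mul h2).mul h1.matrix_transpose

theorem continuous_conjS : Continuous fun p : OrthR n × SymU n => conjS p.1 p.2 := by
  refine Continuous.subtype_mk ?_ _
  have h1 : Continuous fun p : OrthR n × SymU n => cx p.1.1 :=
    continuous_cx.comp (continuous_subtype_val.comp continuous_fst)
  have h2 : Continuous fun p : OrthR n × SymU n => p.2.1 :=
    continuous_subtype_val.comp continuous_snd
  exact (h1.mul h2).mul h1.matrix_transpose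

/-- The identity orthogonal matrix. -/
def oneO : OrthR n := ⟨1, by simp⟩

theorem conjR_one (K : SymR n) : conjR oneO K = K := by
  apply Subtype.ext
  simp [conjR, oneO]

theorem conjS_one (K : SymU n) : conjS oneO K = K := by
  apply Subtype.ext
  simp [conjS, oneO]

/-- If the Cayley transform of `L` is diagonal then `L` is diagonal. -/
theorem diag_of_cay_diag {w : Circle} {L : SymR n} {c : Fin n → Circle} (h : cay w L = dS c) :
    ∃ l : Fin n → ℝ, L = diagR l := by
  have h1 := cay_mul w L
  rw [h] at h1
  have h2 : ∀ i j, (c i : ℂ) * (L.1 i j + I * (1 : Matrix (Fin n) (Fin n) ℂ) i j) =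
      w * (L.1 i j - I * (1 : Matrix (Fin n) (Fin n) ℂ) i j) := by
    intro i j
    have := congrFun (congrFun h1 i) j
    simpa [dS, cden, cnum, diagonal_mul] using this
  have h3 : ∀ i, (w : ℂ) - c i ≠ 0 := by
    intro i hi
    have h4 := h2 i i
    rw [one_apply_eq, sub_eq_zero.1 hi] at h4
    have h5 : (c i : ℂ) * I = 0 := by linear_combination h4 / 2
    exact mul_ne_zero (Circle.coe_ne_zero _) I_ne_zero h5
  refine ⟨fun i => L.1 i i, Subtype.ext ?_⟩
  ext i j
  by_cases hij : i = j
  · subst hij; simp [diagR]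
  · have h4 := h2 i j
    rw [one_apply_ne hij] at h4
    have h5 : ((w : ℂ) - c i) * (L.1 i j : ℂ) = 0 := by linear_combination -h4
    have h6 : L.1 i j = 0 := by exact_mod_cast (mul_eq_zero.1 h5).resolve_left (h3 i)
    simp [diagR, hij, h6]

end DiagonalAndConjugation


/-! ### Paths in the orthogonal group, and the spectral theorem -/

section OrthogonalPaths

open Matrix
open scoped unitInterval

theorem exists_sign_det_ne_zero : ∀ (n : ℕ) (M : Matrix (Fin n) (Fin n) ℝ),
    ∃ s : Fin n → ℝ, (∀ i, s i * s i = 1) ∧ (M + diagonal s).det ≠ 0 := by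
  intro n
  induction n with
  | zero => intro M; exact ⟨fun _ => 1, fun i => i.elim0, by simp⟩
  | succ n ih =>
    intro M
    obtain ⟨s, hs, hdet⟩ := ih (M.submatrix Fin.succ Fin.succ)
    have key : ∀ a : ℝ, (M + diagonal (Fin.cons a s : Fin (n + 1) → ℝ)).det =
        a * (M.submatrix Fin.succ Fin.succ + diagonal s).det +
          (M + diagonal (Fin.cons 0 s : Fin (n + 1) → ℝ)).det := by
      intro a
      have hsub : ∀ (b : ℝ) (g : Fin n → Fin (n + 1)),
          (M + diagonal (Fin.cons b s : Fin (n + 1) → ℝ)).submatrix Fin.succ g =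
          (M + diagonal (Fin.cons 0 s : Fin (n + 1) → ℝ)).submatrix Fin.succ g := by
        intro b g
        ext i j
        simp [diagonal_apply]
      have hsub0 : (M + diagonal (Fin.cons 0 s : Fin (n + 1) → ℝ)).submatrix Fin.succ Fin.succ =
          M.submatrix Fin.succ Fin.succ + diagonal s := by
        ext i j
        simp [diagonal_apply]
      rw [det_succ_row_zero, det_succ_row_zero (M + diagonal (Fin.cons 0 s : Fin (n + 1) → ℝ)),
        Fin.sum_univ_succ, Fin.sum_univ_succ]
      simp only [hsub a]
      rw [← hsub0]
      simp [(Fin.succ_ne_zero _).symm]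
      ring
    by_cases h1 : (M + diagonal (Fin.cons 1 s : Fin (n + 1) → ℝ)).det = 0
    · refine ⟨Fin.cons (-1) s, ?_, ?_⟩
      · intro i
        refine Fin.cases ?_ ?_ i
        · simp
        · intro i; simpa using hs i
      · intro h2
        rw [key] at h1 h2
        apply hdet
        linarith
    · refine ⟨Fin.cons 1 s, ?_, h1⟩
      intro i
      refine Fin.cases ?_ ?_ i
      · simp
      · intro i; simpa using hs i

variable {n : ℕ}

theorem isUnit_one_add_skew {T : Matrix (Fin n) (Fin n) ℝ} (hT : Tᵀ = -T) :
    IsUnit (1 + T).det := by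
  have h : (1 + T) * (1 - T) = 1 + Tᴴ * T := by
    rw [conjTranspose_eq_transpose_of_trivial, hT]; noncomm_ring
  have h2 : IsUnit (1 + Tᴴ * T) :=
    (Matrix.PosDef.one.add_posSemidef (posSemidef_conjTranspose_mul_self _)).isUnit
  rw [← h, Matrix.isUnit_iff_isUnit_det, det_mul] at h2
  exact isUnit_of_mul_isUnit_left h2

theorem cayley_orth {T : Matrix (Fin n) (Fin n) ℝ} (hT : Tᵀ = -T) :
    ((1 - T) * (1 + T)⁻¹) * ((1 - T) * (1 + T)⁻¹)ᵀ = 1 := by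
  have hu := isUnit_one_add_skew hT
  have hT' : (-T)ᵀ = -(-T) := by rw [transpose_neg, hT]
  have hu' : IsUnit (1 - T).det := by
    have := isUnit_one_add_skew hT'
    rwa [← sub_eq_add_neg] at this
  have hc : (1 - T) * (1 + T) = (1 + T) * (1 - T) := by noncomm_ring
  have h2 : (1 + T)⁻¹ * (1 - T)⁻¹ = (1 - T)⁻¹ * (1 + T)⁻¹ := by
    rw [← Matrix.mul_inv_rev, ← Matrix.mul_inv_rev, hc]
  rw [transpose_mul, transpose_nonsing_inv, transpose_sub, transpose_add, transpose_one, hT,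
    ← sub_eq_add_neg, sub_neg_eq_add]
  calc (1 - T) * (1 + T)⁻¹ * ((1 - T)⁻¹ * (1 + T))
      = (1 - T) * ((1 + T)⁻¹ * (1 - T)⁻¹) * (1 + T) := by simp only [mul_assoc]
    _ = (1 - T) * ((1 - T)⁻¹ * ((1 + T)⁻¹ * (1 + T))) := by rw [h2]; simp only [mul_assoc]
    _ = 1 := by rw [nonsing_inv_mul _ hu, mul_one, mul_nonsing_inv _ hu']

theorem continuousAt_matInv_real {X : Type*} [TopologicalSpace X]
    {f : X → Matrix (Fin n) (Fin n) ℝ} {x : X} (hf : ContinuousAt f x) (h : IsUnit (f x).det) :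
    ContinuousAt (fun y => (f y)⁻¹) x := by
  have h1 : ContinuousAt (fun A : Matrix (Fin n) (Fin n) ℝ => A⁻¹) (f x) := by
    refine continuousAt_matrix_inv _ ?_
    obtain ⟨u, hu⟩ := h
    rw [← hu]
    exact NormedRing.inverse_continuousAt u
  exact ContinuousAt.comp (f := f) h1 hf

theorem orth_path_aux (B : OrthR n) (hB : IsUnit (1 + B.1).det) :
    ∃ p : C(I, OrthR n), p 0 = oneO ∧ p 1 = B := by
  have hBB : B.1ᵀ * B.1 = 1 := B.mul_tr
  set A := (1 - B.1) * (1 + B.1)⁻¹ with hA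
  have hAB : A * (1 + B.1) = 1 - B.1 := by
    rw [hA, nonsing_inv_mul_cancel_right _ _ hB]
  have hBt : IsUnit (1 + B.1ᵀ).det := by
    have h := hB
    rw [← det_transpose, transpose_add, transpose_one] at h
    exact h
  have hABt : (1 + B.1ᵀ) * Aᵀ = 1 - B.1ᵀ := by
    have := congrArg transpose hAB
    simpa [transpose_mul] using this
  have hskew : Aᵀ = -A := by
    have h1 : (1 + B.1ᵀ) * Aᵀ * (1 + B.1) = (1 + B.1ᵀ) * (-A) * (1 + B.1) := by
      rw [hABt, mul_assoc, neg_mul, hAB]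
      simp only [add_mul, mul_add, sub_mul, mul_neg, mul_sub, one_mul, mul_one, hBB]
      abel
    have h2 := congrArg (fun M => (1 + B.1ᵀ)⁻¹ * (M * (1 + B.1)⁻¹)) h1
    simp only [mul_nonsing_inv_cancel_right _ _ hB, nonsing_inv_mul_cancel_left _ _ hBt] at h2
    exact h2
  have hs : ∀ t : I, ((t : ℝ) • A)ᵀ = -((t : ℝ) • A) := by
    intro t; rw [transpose_smul, hskew, smul_neg]
  refine ⟨⟨fun t => ⟨(1 - (t : ℝ) • A) * (1 + (t : ℝ) • A)⁻¹, cayley_orth (hs t)⟩, ?_⟩, ?_, ?_⟩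
  · refine Continuous.subtype_mk ?_ _
    have hc : Continuous fun t : I => (t : ℝ) • A := continuous_subtype_val.smul continuous_const
    refine (continuous_const.sub hc).mul ?_
    rw [continuous_iff_continuousAt]
    intro t
    exact continuousAt_matInv_real (continuous_const.add hc).continuousAt
      (isUnit_one_add_skew (hs t))
  · apply Subtype.ext
    simp [oneO]
  · apply Subtype.ext
    have h1 : IsUnit (1 + A).det := isUnit_one_add_skew hskew
    have h2 : B.1 * (1 + A) = 1 - A := by
      have h3 : B.1 * (1 + A) * (1 + B.1) = (1 - A) * (1 + B.1) := by
        rw [mul_assoc, add_mul, sub_mul, hAB]; noncomm_ring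
      have h4 := congrArg (fun M => M * (1 + B.1)⁻¹) h3
      simp only [mul_nonsing_inv_cancel_right _ _ hB] at h4
      exact h4
    change (1 - ((1 : I) : ℝ) • A) * (1 + ((1 : I) : ℝ) • A)⁻¹ = B.1
    rw [Set.Icc.coe_one, one_smul, ← h2, mul_nonsing_inv_cancel_right _ _ h1]

/-- Every orthogonal matrix can be joined to the identity after changing signs of columns. -/
theorem orth_path (o : OrthR n) : ∃ p : C(I, OrthR n), p 0 = oneO ∧
    (∀ κ, conjR (p 1) (diagR κ) = conjR o (diagR κ)) ∧
    (∀ c, conjS (p 1) (dS c) = conjS o (dS c)) := by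
  obtain ⟨s, hs, hdet⟩ := exists_sign_det_ne_zero n o.1
  have hss : diagonal s * diagonal s = (1 : Matrix (Fin n) (Fin n) ℝ) := by
    rw [diagonal_mul_diagonal, ← diagonal_one]; congr 1; ext i; exact hs i
  let B : OrthR n := ⟨o.1 * diagonal s, by
    rw [transpose_mul, diagonal_transpose, mul_assoc, ← mul_assoc (diagonal s), hss, one_mul, o.2]⟩
  have hB : IsUnit (1 + B.1).det := by
    have h1 : 1 + B.1 = (o.1 + diagonal s) * diagonal s := by
      rw [add_mul, hss, add_comm]
    have h2 : (diagonal s).det * (diagonal s).det = 1 := by rw [← det_mul, hss, det_one]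
    rw [h1, det_mul]
    exact (isUnit_iff_ne_zero.2 hdet).mul (isUnit_iff_ne_zero.2 (left_ne_zero_of_mul_eq_one h2))
  obtain ⟨p, h0, h1⟩ := orth_path_aux B hB
  refine ⟨p, h0, ?_, ?_⟩
  · intro κ
    rw [h1]
    apply Subtype.ext
    change o.1 * diagonal s * diagonal κ * (o.1 * diagonal s)ᵀ = o.1 * diagonal κ * o.1ᵀ
    rw [transpose_mul, diagonal_transpose]
    have h2 : diagonal s * diagonal κ * diagonal s = diagonal κ := by
      rw [diagonal_mul_diagonal, diagonal_mul_diagonal]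
      congr 1; ext i
      linear_combination κ i * hs i
    calc o.1 * diagonal s * diagonal κ * (diagonal s * o.1ᵀ)
        = o.1 * (diagonal s * diagonal κ * diagonal s) * o.1ᵀ := by simp only [mul_assoc]
      _ = _ := by rw [h2]
  · intro c
    rw [h1]
    apply Subtype.ext
    change cx (o.1 * diagonal s) * diagonal _ * (cx (o.1 * diagonal s))ᵀ =
      cx o.1 * diagonal _ * (cx o.1)ᵀ
    have hcs : cx (diagonal s) = diagonal fun i => (s i : ℂ) := by
      ext i j
      by_cases h : i = j
      · subst h; simp
      · simp [h]
    rw [map_mul, transpose_mul, hcs, diagonal_transpose]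
    have h2 : (diagonal fun i => (s i : ℂ)) * (diagonal fun i => (c i : ℂ)) *
        (diagonal fun i => (s i : ℂ)) = diagonal fun i => (c i : ℂ) := by
      rw [diagonal_mul_diagonal, diagonal_mul_diagonal]
      congr 1; ext i
      have : (s i : ℂ) * s i = 1 := by exact_mod_cast hs i
      linear_combination (c i : ℂ) * this
    calc cx o.1 * (diagonal fun i => (s i : ℂ)) * (diagonal fun i => (c i : ℂ)) *
          ((diagonal fun i => (s i : ℂ)) * (cx o.1)ᵀ)
        = cx o.1 * ((diagonal fun i => (s i : ℂ)) * (diagonal fun i => (c i : ℂ)) *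
          (diagonal fun i => (s i : ℂ))) * (cx o.1)ᵀ := by simp only [mul_assoc]
      _ = _ := by rw [h2]

theorem spectral_symR (K : SymR n) : ∃ (o : OrthR n) (κ : Fin n → ℝ), conjR o (diagR κ) = K := by
  have hK : K.1.IsHermitian := by
    rw [Matrix.IsHermitian, conjTranspose_eq_transpose_of_trivial, K.2]
  have h := hK.spectral_theorem
  have hu := (Matrix.mem_unitaryGroup_iff (A := (hK.eigenvectorUnitary :
    Matrix (Fin n) (Fin n) ℝ))).1 hK.eigenvectorUnitary.2
  have hst : star (hK.eigenvectorUnitary : Matrix (Fin n) (Fin n) ℝ) =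
    (hK.eigenvectorUnitary : Matrix (Fin n) (Fin n) ℝ)ᵀ := by
      rw [star_eq_conjTranspose, conjTranspose_eq_transpose_of_trivial]
  refine ⟨⟨hK.eigenvectorUnitary, by rw [← hst]; exact hu⟩, hK.eigenvalues, Subtype.ext ?_⟩
  conv_rhs => rw [h]
  rw [Unitary.conjStarAlgAut_apply]
  exact congrArg (fun M => (hK.eigenvectorUnitary : Matrix (Fin n) (Fin n) ℝ) *
    diagonal hK.eigenvalues * M) hst.symm

theorem spectral_path (K : SymR n) : ∃ (κ : Fin n → ℝ) (p : C(I, OrthR n)), p 0 = oneO ∧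
    conjR (p 1) (diagR κ) = K := by
  obtain ⟨o, κ, h⟩ := spectral_symR K
  obtain ⟨p, h0, h1, -⟩ := orth_path o
  exact ⟨κ, p, h0, by rw [h1, h]⟩

end OrthogonalPaths


/-! ### Every loop is homotopic to a diagonal loop -/

section Surjectivity

open Matrix
open scoped unitInterval Topology

variable {n : ℕ}

theorem tr_lemB {z w : Circle} {K L : SymR n} {e : SymU n} (hK : cay z K = e) (hL : cay w L = e) :
    ∃ (κ l : Fin n → ℝ) (h : cay z (diagR κ) = cay w (diagR l)),
      tr (cay z) (diagR κ) K rfl hK = tr (cay w) (diagR l) L h.symm hL := by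
  obtain ⟨κ, p, h0, h1⟩ := spectral_path K
  have h2 : cay w (conjR (p 1).inv L) = cay z (diagR κ) := by
    apply conjS_injective (p 1)
    rw [← cay_conj, ← cay_conj, conjR_inv, h1, hK, hL]
  rw [cay_diagR] at h2
  obtain ⟨l, hl⟩ := diag_of_cay_diag h2
  have h3 : cay z (diagR κ) = cay w (diagR l) := by rw [cay_diagR, ← h2, hl]
  have hc : ∀ M : SymR n, Continuous fun t : I => conjR (p t) M := fun M =>
    continuous_conjR.comp (p.continuous.prodMk continuous_const)
  refine ⟨κ, l, h3, ?_⟩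
  refine tr_congr (cay z) (cay w) ⟨fun t : I => conjR (p t) (diagR κ), hc _⟩
    ⟨fun t : I => conjR (p t) (diagR l), hc _⟩ ?_ 0 1 ?_ ?_ ?_ ?_ _ _ _ _
  · intro t
    simp only [ContinuousMap.coe_mk, cay_conj, h3]
  · simp only [ContinuousMap.coe_mk, h0, conjR_one]
  · exact h1
  · simp only [ContinuousMap.coe_mk, h0, conjR_one]
  · simp only [ContinuousMap.coe_mk, ← hl, conjR_inv]

theorem tr_lemC {z : Circle} {θ κ : Fin n → ℝ} (h : Dexp θ = cay z (diagR κ)) (κ₁ : Fin n → ℝ) :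
    ∃ (θ₁ : Fin n → ℝ) (h₁ : Dexp θ₁ = cay z (diagR κ₁)),
      (tr Dexp 0 θ rfl h).trans (tr (cay z) (diagR κ) (diagR κ₁) rfl rfl) =
        tr Dexp 0 θ₁ rfl h₁ := by
  have hj := (Dexp_eq_cay_iff z θ κ).1 h
  let T : C(Fin n → ℝ, Fin n → ℝ) :=
    ⟨fun κ' j => θ j - argc (κ j) + argc (κ' j), continuous_pi fun j =>
      continuous_const.add (continuous_argc.comp (continuous_apply j))⟩
  have hT : ∀ κ', Dexp (T κ') = cay z (diagR κ') := by
    intro κ'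
    rw [Dexp_eq_cay_iff]
    intro j
    change Circle.exp (θ j - argc (κ j) + argc (κ' j)) = _
    rw [Circle.exp_add, Circle.exp_sub, hj j, mul_div_cancel_right]
  have hT0 : T κ = θ := by
    ext j
    change θ j - argc (κ j) + argc (κ j) = θ j
    ring
  refine ⟨T κ₁, hT κ₁, ?_⟩
  have h2 : tr (cay z) (diagR κ) (diagR κ₁) rfl rfl = tr Dexp θ (T κ₁) h (hT κ₁) :=
    tr_congr (cay z) Dexp diagR T (fun t => (hT t).symm) κ κ₁ rfl rfl hT0 rfl _ _ _ _
  rw [h2, tr_trans]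

/-- The class `g` is a diagonal path followed by a path in the Cayley chart. -/
def DRep (z : Circle) (K : SymR n) {e : SymU n} (hK : cay z K = e)
    (g : Path.Homotopic.Quotient (Dexp (n := n) 0) e) : Prop :=
  ∃ (θ κ : Fin n → ℝ) (h : Dexp θ = cay z (diagR κ)),
    g = (tr Dexp 0 θ rfl h).trans (tr (cay z) (diagR κ) K rfl hK)

theorem DRep.normalize {z : Circle} {K : SymR n} {e : SymU n} {hK : cay z K = e}
    {g : Path.Homotopic.Quotient (Dexp (n := n) 0) e} (h : DRep z K hK g) (κ₁ : Fin n → ℝ) :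
    ∃ (θ : Fin n → ℝ) (h : Dexp θ = cay z (diagR κ₁)),
      g = (tr Dexp 0 θ rfl h).trans (tr (cay z) (diagR κ₁) K rfl hK) := by
  obtain ⟨θ, κ, h, rfl⟩ := h
  obtain ⟨θ₁, h₁, h₂⟩ := tr_lemC h κ₁
  refine ⟨θ₁, h₁, ?_⟩
  rw [← h₂, Path.Homotopic.Quotient.trans_assoc, tr_trans]

theorem tr_trans_mid {S X Y : Type*} [TopologicalSpace S] [TopologicalSpace X]
    [SimplyConnectedSpace X] [TopologicalSpace Y] [SimplyConnectedSpace Y] (f : C(X, S))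
    (g : C(Y, S)) {x x' : X} {y y' : Y} {a b b' c : S} (h1 : f x = a) (h2 : f x' = b)
    (h2' : f x' = b') (h3 : g y = b) (h3' : g y = b') (h4 : g y' = c) :
    (tr f x x' h1 h2).trans (tr g y y' h3 h4) = (tr f x x' h1 h2').trans (tr g y y' h3' h4) := by
  subst h2 h2'
  rfl

theorem DRep.change {z w : Circle} {K L : SymR n} {e : SymU n} {hK : cay z K = e}
    {g : Path.Homotopic.Quotient (Dexp (n := n) 0) e} (h : DRep z K hK g) (hL : cay w L = e) :
    DRep w L hL g := by
  obtain ⟨κ, l, h1, h2⟩ := tr_lemB hK hL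
  obtain ⟨θ, h3, rfl⟩ := h.normalize κ
  refine ⟨θ, l, h3.trans h1, ?_⟩
  rw [h2]
  exact tr_trans_mid _ _ _ _ _ _ _ _

theorem DRep.step {z : Circle} {K K' : SymR n} {e e' : SymU n} {hK : cay z K = e}
    {g : Path.Homotopic.Quotient (Dexp (n := n) 0) e} (h : DRep z K hK g) (hK' : cay z K' = e') :
    DRep z K' hK' (g.trans (tr (cay z) K K' hK hK')) := by
  obtain ⟨θ, κ, h, rfl⟩ := h
  refine ⟨θ, κ, h, ?_⟩
  rw [Path.Homotopic.Quotient.trans_assoc, tr_trans]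

instance locallyPathConnected_I_inst : LocallyPathConnectedSpace I :=
  (isQuotientMap_projIcc (h := zero_le_one (α := ℝ))).locallyPathConnectedSpace

/-- Goodness of a class: representable in some (equivalently, every) chart. -/
def GoodC {e : SymU n} (g : Path.Homotopic.Quotient (Dexp (n := n) 0) e) : Prop :=
  ∃ (z : Circle) (K : SymR n) (h : cay z K = e), DRep z K h g

theorem cay_zero_eq : cay (Circle.exp Real.pi) (diagR (n := n) 0) = Dexp 0 := by
  symm
  rw [Dexp_eq_cay_iff]
  intro j
  rw [← Circle.exp_add]
  simp [argc]

theorem goodC_base {X : Type*} [TopologicalSpace X] [SimplyConnectedSpace X] (f : C(X, SymU n))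
    (x : X) {e : SymU n} (h0 : f x = Dexp 0) (h1 : f x = e) : GoodC (tr f x x h0 h1) := by
  obtain rfl : e = Dexp 0 := h1.symm.trans h0
  rw [tr_self]
  refine ⟨Circle.exp Real.pi, diagR 0, cay_zero_eq, 0, 0, cay_zero_eq.symm, ?_⟩
  have h2 : tr (cay (Circle.exp Real.pi)) (diagR (n := n) 0) (diagR 0) rfl cay_zero_eq =
      tr Dexp 0 0 cay_zero_eq.symm rfl :=
    tr_congr (Z := Unit) _ _ (.const _ (diagR 0)) (.const _ 0) (fun _ => cay_zero_eq) () ()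
      rfl rfl rfl rfl _ _ _ _
  rw [h2, tr_trans, tr_self]

theorem goodC_path (γ : C(I, SymU n)) (h0 : γ 0 = Dexp 0) {e : SymU n} (he : γ 1 = e) :
    GoodC (tr γ 0 1 h0 he) := by
  subst he
  have key : ∀ t₀ : I, ∃ U ∈ 𝓝 t₀, ∀ t ∈ U, ∀ s ∈ U,
      GoodC (tr γ 0 t h0 rfl) → GoodC (tr γ 0 s h0 rfl) := by
    intro t₀
    obtain ⟨z, hz⟩ := exists_mem_Vz (γ t₀)
    have hU : γ ⁻¹' (Vz z) ∈ 𝓝 t₀ := ((isOpen_Vz z).preimage γ.continuous).mem_nhds hz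
    obtain ⟨U, ⟨hU1, hU2⟩, hU3⟩ :=
      (LocallyPathConnectedSpace.path_connected_basis t₀).mem_iff.1 hU
    refine ⟨U, hU1, ?_⟩
    intro t ht s hs hgood
    have : PathConnectedSpace U := isPathConnected_iff_pathConnectedSpace.1 hU2
    have hk : ∀ u : U, cay z (kay z (γ u)) = γ u := fun u => cay_kay z _ (hU3 u.2)
    have hcont : Continuous fun u : U => kay z (γ u) := by
      have := (continuousOn_kay (n := n) z).comp_continuous
        (γ.continuous.comp (continuous_subtype_val (p := fun x => x ∈ U))) (fun u => hU3 u.2)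
      exact this
    have h1 : tr γ t s rfl rfl = tr (cay z) (kay z (γ t)) (kay z (γ s)) (hk ⟨t, ht⟩)
        (hk ⟨s, hs⟩) :=
      tr_congr γ (cay z) ⟨fun u : U => (u : I), continuous_subtype_val⟩
        ⟨fun u : U => kay z (γ u), hcont⟩ (fun u => (hk u).symm) ⟨t, ht⟩ ⟨s, hs⟩
        rfl rfl rfl rfl _ _ _ _
    obtain ⟨w, K, hK, hrep⟩ := hgood
    refine ⟨z, kay z (γ s), hk ⟨s, hs⟩, ?_⟩
    have h2 := (hrep.change (hk ⟨t, ht⟩)).step (hk ⟨s, hs⟩)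
    rw [← h1, tr_trans] at h2
    exact h2
  have hclopen : IsClopen {t : I | GoodC (tr γ 0 t h0 rfl)} := by
    constructor
    · rw [← isOpen_compl_iff, isOpen_iff_mem_nhds]
      intro t₀ ht₀
      obtain ⟨U, hU, h⟩ := key t₀
      refine Filter.mem_of_superset hU ?_
      intro t ht hgood
      exact ht₀ (h t ht t₀ (mem_of_mem_nhds hU) hgood)
    · rw [isOpen_iff_mem_nhds]
      intro t₀ ht₀
      obtain ⟨U, hU, h⟩ := key t₀
      refine Filter.mem_of_superset hU ?_
      intro t ht
      exact h t₀ (mem_of_mem_nhds hU) t ht ht₀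
  have h2 := hclopen.eq_univ ⟨0, goodC_base γ 0 h0 rfl⟩
  have h3 : (1 : I) ∈ {t : I | GoodC (tr γ 0 t h0 rfl)} := by rw [h2]; exact Set.mem_univ _
  exact h3

/-- Every loop at the identity is homotopic to a diagonal loop. -/
theorem loop_eq_diag (g : Path.Homotopic.Quotient (Dexp (n := n) 0) (Dexp 0)) :
    ∃ (θ : Fin n → ℝ) (h : Dexp θ = Dexp 0), g = tr Dexp 0 θ rfl h := by
  induction g using Path.Homotopic.Quotient.ind with
  | mk p =>
  have h0 := goodC_path p.toContinuousMap p.source p.target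
  rw [tr_unitInterval] at h0
  obtain ⟨z, K, h, h1⟩ := h0
  obtain ⟨θ, h3, h4⟩ := (h1.change cay_zero_eq).normalize 0
  refine ⟨θ, h3.trans cay_zero_eq, ?_⟩
  have h2 : tr (cay (Circle.exp Real.pi)) (diagR (n := n) 0) (diagR 0) rfl cay_zero_eq =
      tr Dexp θ θ h3 (h3.trans cay_zero_eq) :=
    tr_congr (Z := Unit) _ _ (.const _ (diagR 0)) (.const _ θ) (fun _ => h3.symm) () ()
      rfl rfl rfl rfl _ _ _ _
  rw [h4, h2, tr_trans]

end Surjectivity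


/-! ### The diagonal loops, and the fundamental group of the symmetric unitary matrices -/

section DiagonalLoops

open Matrix
open scoped unitInterval Topology

variable {n : ℕ}

theorem tr_map {S S' X : Type*} [TopologicalSpace S] [TopologicalSpace S'] [TopologicalSpace X]
    [SimplyConnectedSpace X] (f : C(X, S)) (g : C(S, S')) {x y : X} {a b : S} (hx : f x = a)
    (hy : f y = b) :
    (tr f x y hx hy).map g = tr (g.comp f) x y (congrArg g hx) (congrArg g hy) := by
  subst hx hy
  let p := PathConnectedSpace.somePath x y
  rw [tr_eq_mk f rfl rfl p (p.map f.continuous) (fun _ => rfl),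
    tr_eq_mk (g.comp f) rfl rfl p ((p.map f.continuous).map g.continuous) (fun _ => rfl)]
  rfl

theorem eq_of_tr_eq_refl {S X : Type*} [TopologicalSpace S] [TopologicalSpace X]
    [SimplyConnectedSpace X] (f : C(X, S)) (cov : IsCoveringMap f) {x y : X} {a : S}
    (hx : f x = a) (hy : f y = a) (h : tr f x y hx hy = .refl a) : x = y := by
  have h1 : cov.monodromy (Path.Homotopic.Quotient.refl a) ⟨x, hx⟩ = ⟨y, hy⟩ := by
    have h2 : (Path.Homotopic.Quotient.mk (PathConnectedSpace.somePath x y)).map f =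
        (Path.Homotopic.Quotient.refl a).cast hx hy := by
      rw [← h, tr, Path.Homotopic.Quotient.cast_cast, Path.Homotopic.Quotient.cast_rfl_rfl]
    exact cov.monodromy_eq_of_map_eq
      (Path.Homotopic.Quotient.mk (PathConnectedSpace.somePath x y)) h2
  rw [cov.monodromy_refl] at h1
  exact congrArg Subtype.val h1

/-- Periods of the exponential map. -/
noncomputable def per (m : Fin n → ℤ) : Fin n → ℝ := fun j => 2 * Real.pi * m j

theorem per_add (m m' : Fin n → ℤ) : per (m + m') = per m + per m' := by
  ext j; simp [per]; ring

theorem Dexp_add_per (x : Fin n → ℝ) (m : Fin n → ℤ) : Dexp (x + per m) = Dexp x := by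
  change dS _ = dS _
  congr 1
  ext j
  simp [per, Circle.exp_add, Circle.exp_two_pi_mul_int]

theorem Dexp_per (m : Fin n → ℤ) : Dexp (per m) = Dexp 0 := by
  rw [← Dexp_add_per 0 m, zero_add]

/-- The diagonal loop with winding numbers `m`. -/
noncomputable def psi (m : Fin n → ℤ) : Path.Homotopic.Quotient (Dexp (n := n) 0) (Dexp 0) :=
  tr Dexp 0 (per m) rfl (Dexp_per m)

theorem psi_zero : psi (0 : Fin n → ℤ) = .refl _ := by
  have h : per (0 : Fin n → ℤ) = 0 := by ext j; simp [per]
  unfold psi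
  exact tr_const (Z := Unit) _ (.const _ 0) (fun _ => rfl) () () rfl h.symm _ _

theorem psi_add (m m' : Fin n → ℤ) : psi (m + m') = (psi m).trans (psi m') := by
  have h0 : Dexp (per m + per m') = Dexp 0 := by rw [← per_add, Dexp_per]
  have h1 : psi m' = tr Dexp (per m) (per m + per m') (Dexp_per m) h0 := by
    refine tr_congr Dexp Dexp (ContinuousMap.id (Fin n → ℝ))
      ⟨fun x => x + per m, continuous_id.add continuous_const⟩ ?_ 0 (per m') rfl rfl ?_ ?_ _ _ _ _
    · intro x; exact (Dexp_add_per x m).symm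
    · exact zero_add _
    · exact add_comm _ _
  rw [h1]
  unfold psi
  rw [tr_trans]
  simp only [per_add]

theorem dS_one_eq : (Dexp (n := n) 0).1 = 1 := by
  change diagonal (fun j => (Circle.exp ((0 : Fin n → ℝ) j) : ℂ)) = 1
  simp

theorem conjS_Dexp_zero (o : OrthR n) : conjS o (Dexp 0) = Dexp 0 := by
  apply Subtype.ext
  change cx o.1 * (Dexp (n := n) 0).1 * (cx o.1)ᵀ = (Dexp (n := n) 0).1
  rw [dS_one_eq, mul_one, OrthR.cx_tr_mul]

/-- Permutation matrices. -/
def permO (π : Equiv.Perm (Fin n)) : OrthR n :=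
  ⟨(1 : Matrix (Fin n) (Fin n) ℝ).submatrix π (Equiv.refl _), by
    rw [transpose_submatrix, submatrix_mul_equiv, transpose_one, mul_one, submatrix_one_equiv]⟩

theorem conjS_permO (π : Equiv.Perm (Fin n)) (c : Fin n → Circle) :
    conjS (permO π) (dS c) = dS (c ∘ π) := by
  have h : cx (permO π).1 = (1 : Matrix (Fin n) (Fin n) ℂ).submatrix π (Equiv.refl _) := by
    ext i j
    simp [permO, one_apply]
  apply Subtype.ext
  change cx (permO π).1 * diagonal (fun j => (c j : ℂ)) * (cx (permO π).1)ᵀ =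
    diagonal fun j => (c (π j) : ℂ)
  have h2 : diagonal (fun j => (c j : ℂ)) =
    (diagonal (fun j => (c j : ℂ))).submatrix (Equiv.refl _) (Equiv.refl _) := rfl
  rw [h, h2, transpose_submatrix, submatrix_mul_equiv, submatrix_mul_equiv, transpose_one,
    mul_one, one_mul, submatrix_diagonal_equiv]
  rfl

theorem tr_square {S Y : Type*} [TopologicalSpace S] [TopologicalSpace Y] [ContractibleSpace Y]
    (F : C(I × Y, S)) (f₀ f₁ : C(Y, S)) {x y : Y} {a : S}
    (hx : ∀ s, F (s, x) = a) (hy : ∀ s, F (s, y) = a) (h₀ : ∀ θ, F (0, θ) = f₀ θ)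
    (h₁ : ∀ θ, F (1, θ) = f₁ θ) (a₁ : f₀ x = a) (a₂ : f₀ y = a) (a₃ : f₁ x = a) (a₄ : f₁ y = a) :
    tr f₀ x y a₁ a₂ = tr f₁ x y a₃ a₄ := by
  have e1 : tr F (0, x) (0, y) (hx _) (hy _) = tr f₀ x y a₁ a₂ :=
    tr_congr F f₀ ⟨fun θ => ((0 : I), θ), by fun_prop⟩ (ContinuousMap.id _) h₀ x y
      rfl rfl rfl rfl _ _ _ _
  have e2 : tr F (1, x) (1, y) (hx _) (hy _) = tr f₁ x y a₃ a₄ :=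
    tr_congr F f₁ ⟨fun θ => ((1 : I), θ), by fun_prop⟩ (ContinuousMap.id _) h₁ x y
      rfl rfl rfl rfl _ _ _ _
  have e3 : tr F (0, y) (1, y) (hy _) (hy _) = .refl _ :=
    tr_const F ⟨fun s : I => (s, y), by fun_prop⟩ hy 0 1 rfl rfl _ _
  have e4 : tr F (0, x) (1, x) (hx _) (hx _) = .refl _ :=
    tr_const F ⟨fun s : I => (s, x), by fun_prop⟩ hx 0 1 rfl rfl _ _
  have e5 := tr_trans F (0, x) (0, y) (1, y) (hx _) (hy _) (hy _)
  have e6 := tr_trans F (0, x) (1, x) (1, y) (hx _) (hx _) (hy _)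
  rw [e1, e3, Path.Homotopic.Quotient.trans_refl] at e5
  rw [e4, e2, ← e5, Path.Homotopic.Quotient.refl_trans] at e6
  exact e6.symm

/-- Precomposition with a permutation. -/
def permC (π : Equiv.Perm (Fin n)) : C(Fin n → ℝ, Fin n → ℝ) :=
  ⟨fun θ => θ ∘ π, continuous_pi fun j => continuous_apply (π j)⟩

theorem Dexp_apply (θ : Fin n → ℝ) : Dexp θ = dS fun j => Circle.exp (θ j) := rfl

theorem exists_conj_family (p : C(I, OrthR n)) : ∃ F : C(I × (Fin n → ℝ), SymU n),
    ∀ s θ, F (s, θ) = conjS (p s) (Dexp θ) := by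
  have h3 : Continuous fun q : I × (Fin n → ℝ) => p q.1 :=
    Continuous.comp (g := fun s : I => p s) (map_continuous p) continuous_fst
  have h4 : Continuous fun q : I × (Fin n → ℝ) => Dexp q.2 :=
    Continuous.comp (g := fun θ : Fin n → ℝ => Dexp θ) (map_continuous (Dexp (n := n)))
      continuous_snd
  have h1 : Continuous (fun q : I × (Fin n → ℝ) => ((p q.1, Dexp q.2) : OrthR n × SymU n)) := by
    exact Continuous.prodMk h3 h4
  have h2 : Continuous fun q : I × (Fin n → ℝ) => conjS (p q.1) (Dexp q.2) := by
    have h5 := (continuous_conjS (n := n))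
    have h6 := h5.comp h1
    exact h6
  exact ⟨⟨_, h2⟩, fun _ _ => rfl⟩

theorem psi_perm (m : Fin n → ℤ) (π : Equiv.Perm (Fin n)) : psi m = psi (m ∘ π) := by
  obtain ⟨p, h0, -, h1⟩ := orth_path (permO π)
  obtain ⟨F, hFd⟩ := exists_conj_family p
  have hc : ∀ θ, Dexp.comp (permC π) θ = conjS (permO π) (Dexp θ) := by
    intro θ
    rw [ContinuousMap.comp_apply, Dexp_apply, Dexp_apply, conjS_permO]
    rfl
  have e1 : psi m = tr (Dexp.comp (permC π)) 0 (per m) (by rw [hc, conjS_Dexp_zero])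
      (by rw [hc, Dexp_per, conjS_Dexp_zero]) := by
    refine tr_square F _ _ ?_ ?_ ?_ ?_ _ _ _ _
    · intro s; rw [hFd, conjS_Dexp_zero]
    · intro s; rw [hFd, Dexp_per, conjS_Dexp_zero]
    · intro θ; rw [hFd, h0, conjS_one]
    · intro θ; rw [hFd, hc, Dexp_apply]; exact h1 _
  rw [e1]
  have h2 : permC π (0 : Fin n → ℝ) = 0 := rfl
  have h3 : permC π (per m) = per (m ∘ π) := rfl
  exact tr_congr (Dexp.comp (permC π)) Dexp (ContinuousMap.id _) (permC π) (fun _ => rfl)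
    0 (per m) rfl rfl h2 h3 _ _ _ _

theorem psi_single (i i₀ : Fin n) (k : ℤ) :
    psi (Pi.single i k) = psi (Pi.single i₀ k) := by
  rw [psi_perm (Pi.single i k) (Equiv.swap i i₀)]
  congr 1
  ext j
  by_cases h : j = i₀
  · subst h; simp
  · have : Equiv.swap i i₀ j ≠ i := by
      intro h2
      apply h
      rw [← Equiv.swap_apply_left i i₀] at h2
      have h3 := congrArg (Equiv.swap i i₀) h2
      simpa using h3
    simp [h, this]

theorem psi_eq_single (i₀ : Fin n) (m : Fin n → ℤ) :
    psi m = psi (Pi.single i₀ (∑ i, m i)) := by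
  have h : ∀ s : Finset (Fin n), psi (∑ i ∈ s, Pi.single i (m i)) =
      psi (Pi.single i₀ (∑ i ∈ s, m i)) := by
    intro s
    induction s using Finset.induction_on with
    | empty => simp
    | insert a s ha ih =>
      rw [Finset.sum_insert ha, Finset.sum_insert ha, psi_add, ih, psi_single a i₀, ← psi_add,
        Pi.single_add]
  rw [← h Finset.univ, Finset.univ_sum_single]

theorem det_mem_circle (A : SymU n) : A.1.det ∈ Submonoid.unitSphere ℂ := by
  have h := congrArg Matrix.det A.2.2
  rw [det_mul, det_conjTranspose, det_one, Complex.star_def, Complex.mul_conj] at h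
  have h2 : Complex.normSq A.1.det = 1 := by exact_mod_cast h
  rw [Complex.normSq_eq_norm_sq, pow_eq_one_iff_of_nonneg (norm_nonneg _) two_ne_zero] at h2
  exact mem_sphere_zero_iff_norm.2 h2

/-- The determinant, as a map to the circle. -/
noncomputable def detC : C(SymU n, Circle) where
  toFun A := ⟨A.1.det, det_mem_circle A⟩
  continuous_toFun := Continuous.subtype_mk continuous_subtype_val.matrix_det _

theorem detC_Dexp (θ : Fin n → ℝ) : detC (Dexp θ) = Circle.exp (∑ i, θ i) := by
  apply Circle.ext
  change (diagonal fun j => (Circle.exp (θ j) : ℂ)).det = _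
  rw [det_diagonal, Circle.coe_exp]
  simp only [Circle.coe_exp]
  rw [← Complex.exp_sum]
  push_cast
  rw [Finset.sum_mul]

theorem sum_eq_zero_of_psi (m : Fin n → ℤ) (h : psi m = .refl _) : ∑ i, m i = 0 := by
  have h1 := congrArg (fun g => g.map detC) h
  simp only [psi, tr_map] at h1
  have hs : ∀ θ : Fin n → ℝ, (detC.comp Dexp) θ = Circle.exp (∑ i, θ i) := detC_Dexp
  have hp : Circle.exp (∑ i, per m i) = detC (Dexp (n := n) 0) := by
    rw [← Dexp_per m, detC_Dexp]
  have h0 : Circle.exp 0 = detC (Dexp (n := n) 0) := by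
    rw [detC_Dexp]; simp
  have h2 : tr (detC.comp Dexp) 0 (per m) rfl (congrArg detC (Dexp_per m)) =
      tr Circle.exp 0 (∑ i, per m i) h0 hp :=
    tr_congr _ _ (ContinuousMap.id _)
      ⟨fun θ : Fin n → ℝ => ∑ i, θ i, by fun_prop⟩ hs 0 (per m) rfl rfl (by simp) rfl _ _ _ _
  have h3 := eq_of_tr_eq_refl Circle.exp Circle.isCoveringMap_exp h0 hp (h2.symm.trans h1)
  simp only [per, ← Finset.mul_sum] at h3
  have h4 := (mul_eq_zero.1 h3.symm).resolve_left (by positivity)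
  exact_mod_cast h4

/-- The fundamental group of the space of symmetric unitary matrices. -/
theorem pi1_symU (i₀ : Fin n) :
    Nonempty (Multiplicative ℤ ≃* FundamentalGroup (SymU n) (Dexp 0)) := by
  let φ : Multiplicative ℤ →* FundamentalGroup (SymU n) (Dexp 0) :=
    { toFun := fun k => psi (Pi.single i₀ k.toAdd)
      map_one' := by
        change psi (Pi.single i₀ 0) = .refl _
        rw [Pi.single_zero, psi_zero]
      map_mul' := by
        intro a b
        change psi (Pi.single i₀ (a.toAdd + b.toAdd)) =
          (psi (Pi.single i₀ b.toAdd)).trans (psi (Pi.single i₀ a.toAdd))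
        rw [← psi_add, add_comm, Pi.single_add] }
  refine ⟨MulEquiv.ofBijective φ ⟨?_, ?_⟩⟩
  · rw [injective_iff_map_eq_one]
    intro a ha
    have h := sum_eq_zero_of_psi (Pi.single i₀ a.toAdd) ha
    rw [Finset.sum_pi_single'] at h
    have h2 : a.toAdd = 0 := by simpa using h
    exact h2
  · intro g
    obtain ⟨θ, h, hg⟩ := loop_eq_diag g
    have h2 : ∃ m : Fin n → ℤ, θ = per m := by
      have h3 := dS_injective h
      have h4 : ∀ j, ∃ m : ℤ, θ j = m * (2 * Real.pi) := by
        intro j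
        rw [← Circle.exp_eq_one]
        simpa using congrFun h3 j
      choose m hm using h4
      exact ⟨m, by ext j; rw [hm]; simp [per]; ring⟩
    obtain ⟨m, rfl⟩ := h2
    refine ⟨Multiplicative.ofAdd (∑ i, m i), ?_⟩
    rw [hg]
    exact (psi_eq_single i₀ m).symm

end DiagonalLoops

/-! ### The homeomorphism between `U(n)/O(n)` and the symmetric unitary matrices -/

section Homeo

open Matrix
open scoped unitInterval Topology

variable {n : ℕ}

theorem symU_diag (A : SymU n) : ∃ (z : Circle) (o : OrthR n) (κ : Fin n → ℝ),
    A = cay z (conjR o (diagR κ)) := by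
  obtain ⟨z, hz⟩ := exists_mem_Vz A
  obtain ⟨o, κ, h⟩ := spectral_symR (kay z A)
  exact ⟨z, o, κ, by rw [h, cay_kay z A hz]⟩

theorem symU_diag' (A : SymU n) : ∃ (o : OrthR n) (θ : Fin n → ℝ), A = conjS o (Dexp θ) := by
  obtain ⟨z, o, κ, h⟩ := symU_diag A
  obtain ⟨t, ht⟩ : ∃ t : ℝ, Circle.exp t = z := ⟨_, Circle.exp_arg z⟩
  refine ⟨o, fun j => t + argc (κ j), ?_⟩
  rw [h, cay_conj]
  congr 1
  symm
  rw [Dexp_eq_cay_iff]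
  intro j
  rw [Circle.exp_add, ht]

theorem pathConnected_symU : PathConnectedSpace (SymU n) := by
  have key : ∀ A : SymU n, Joined A (Dexp 0) := by
    intro A
    obtain ⟨z, o, κ, h⟩ := symU_diag A
    obtain ⟨t, ht⟩ : ∃ t : ℝ, Circle.exp t = z := ⟨_, Circle.exp_arg z⟩
    have h1 : Joined (cay z (conjR o (diagR κ))) (cay z (diagR κ)) :=
      ⟨(PathConnectedSpace.somePath (conjR o (diagR κ)) (diagR κ)).map (map_continuous (cay z))⟩
    have h2 : Dexp (fun j => t + argc (κ j)) = cay z (diagR κ) := by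
      rw [Dexp_eq_cay_iff]
      intro j
      rw [Circle.exp_add, ht]
    have h3 : Joined (Dexp (fun j => t + argc (κ j))) (Dexp 0) :=
      ⟨(PathConnectedSpace.somePath (fun j => t + argc (κ j)) 0).map (map_continuous Dexp)⟩
    rw [h]
    rw [h2] at h3
    exact h1.trans h3
  exact ⟨⟨Dexp 0⟩, fun A B => (key A).trans (key B).symm⟩

/-- The map `U ↦ U Uᵀ`. -/
noncomputable def sqU (U : Matrix.unitaryGroup (Fin n) ℂ) : SymU n :=
  ⟨U.1 * U.1ᵀ, by rw [transpose_mul, transpose_transpose], by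
    have h1 : U.1 * U.1ᴴ = 1 := mem_unitaryGroup_iff.1 U.2
    have h2 : U.1ᵀ * U.1ᵀᴴ = 1 := by
      have h3 : U.1ᴴ * U.1 = 1 := mem_unitaryGroup_iff'.1 U.2
      have h4 := congrArg Matrix.transpose h3
      rwa [transpose_mul, transpose_one] at h4
    rw [conjTranspose_mul, mul_assoc, ← mul_assoc U.1ᵀ, h2, one_mul, h1]⟩

theorem continuous_sqU : Continuous (sqU (n := n)) := by
  refine Continuous.subtype_mk ?_ _
  exact continuous_subtype_val.mul continuous_subtype_val.matrix_transpose

theorem sqU_mul (U V : Matrix.unitaryGroup (Fin n) ℂ) :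
    (sqU (U * V)).1 = U.1 * (sqU V).1 * U.1ᵀ := by
  change (U.1 * V.1) * (U.1 * V.1)ᵀ = U.1 * (V.1 * V.1ᵀ) * U.1ᵀ
  rw [transpose_mul]; simp only [mul_assoc]

theorem sqU_eq_one_iff (V : Matrix.unitaryGroup (Fin n) ℂ) :
    (sqU V).1 = 1 ↔ V ∈ realOrthogonalSubgroup n := by
  have h1 : V.1 * V.1ᴴ = 1 := mem_unitaryGroup_iff.1 V.2
  have h3 : V.1ᴴ * V.1 = 1 := mem_unitaryGroup_iff'.1 V.2
  have h4 : (sqU V).1 = 1 ↔ V.1ᴴ = V.1ᵀ := by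
    change V.1 * V.1ᵀ = 1 ↔ _
    constructor
    · intro h
      exact left_inv_eq_right_inv h3 h
    · intro h
      rw [← h, h1]
  rw [h4]
  constructor
  · intro h i j
    have h5 := congrFun (congrFun h j) i
    exact Complex.conj_eq_iff_im.1 h5
  · intro h
    ext i j
    exact Complex.conj_eq_iff_im.2 (h j i)

theorem sqU_eq_iff (U V : Matrix.unitaryGroup (Fin n) ℂ) :
    sqU U = sqU V ↔ U⁻¹ * V ∈ realOrthogonalSubgroup n := by
  rw [← sqU_eq_one_iff, sqU_mul, Subtype.ext_iff]
  have h1 : U.1 * U.1ᴴ = 1 := mem_unitaryGroup_iff.1 U.2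
  have h3 : U.1ᴴ * U.1 = 1 := mem_unitaryGroup_iff'.1 U.2
  have h1' : U.1ᴴᵀ * U.1ᵀ = 1 := by rw [← transpose_mul, h1, transpose_one]
  have h3' : U.1ᵀ * U.1ᴴᵀ = 1 := by rw [← transpose_mul, h3, transpose_one]
  change U.1 * U.1ᵀ = (sqU V).1 ↔ U.1ᴴ * (sqU V).1 * U.1ᴴᵀ = 1
  constructor
  · intro h
    rw [← h, ← mul_assoc, h3, one_mul, h3']
  · intro h
    calc U.1 * U.1ᵀ = U.1 * (U.1ᴴ * (sqU V).1 * U.1ᴴᵀ) * U.1ᵀ := by rw [h, mul_one]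
      _ = (U.1 * U.1ᴴ) * (sqU V).1 * (U.1ᴴᵀ * U.1ᵀ) := by simp only [mul_assoc]
      _ = (sqU V).1 := by rw [h1, h1', one_mul, mul_one]

theorem sqU_surjective : Function.Surjective (sqU (n := n)) := by
  intro A
  obtain ⟨o, θ, h⟩ := symU_diag' A
  let D : SymU n := Dexp (fun j => θ j / 2)
  let O' : Matrix.unitaryGroup (Fin n) ℂ := ⟨cx o.1, by
    rw [mem_unitaryGroup_iff]
    change cx o.1 * (cx o.1)ᴴ = 1
    rw [cx_conjTranspose, OrthR.cx_tr_mul]⟩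
  let D' : Matrix.unitaryGroup (Fin n) ℂ := ⟨D.1, mem_unitaryGroup_iff.2 D.2.2⟩
  refine ⟨O' * D', ?_⟩
  apply Subtype.ext
  rw [sqU_mul, h]
  change cx o.1 * (D.1 * D.1ᵀ) * (cx o.1)ᵀ = cx o.1 * (Dexp θ).1 * (cx o.1)ᵀ
  congr 2
  rw [D.2.1]
  change diagonal (fun j => (Circle.exp (θ j / 2) : ℂ)) *
    diagonal (fun j => (Circle.exp (θ j / 2) : ℂ)) = diagonal (fun j => (Circle.exp (θ j) : ℂ))
  rw [diagonal_mul_diagonal]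
  congr 1
  ext j
  rw [← Circle.coe_mul, ← Circle.exp_add, add_halves]

theorem compact_unitary : CompactSpace (Matrix.unitaryGroup (Fin n) ℂ) := by
  refine isCompact_iff_compactSpace (s := (Matrix.unitaryGroup (Fin n) ℂ : Set (Matrix (Fin n) (Fin n) ℂ))).1 ?_
  have h1 : IsCompact {M : Matrix (Fin n) (Fin n) ℂ |
      ∀ i, M i ∈ Set.pi Set.univ fun _ => Metric.closedBall (0 : ℂ) 1} :=
    isCompact_pi_infinite fun i => isCompact_univ_pi fun j => isCompact_closedBall 0 1
  refine h1.of_isClosed_subset ?_ ?_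
  · have h2 : (Matrix.unitaryGroup (Fin n) ℂ : Set (Matrix (Fin n) (Fin n) ℂ)) =
        {M | M * Mᴴ = 1} := by
      ext M; exact mem_unitaryGroup_iff
    rw [h2]
    exact isClosed_eq (continuous_id.mul continuous_id.matrix_conjTranspose) continuous_const
  · intro U hU i j _
    rw [mem_closedBall_zero_iff]
    exact entry_norm_bound_of_unitary hU i j

/-- The quotient map. -/
noncomputable def quoS : Matrix.unitaryGroup (Fin n) ℂ ⧸ realOrthogonalSubgroup n → SymU n :=
  Quotient.lift sqU fun U V h => (sqU_eq_iff U V).2 (QuotientGroup.leftRel_apply.1 h)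

theorem quoS_bijective : Function.Bijective (quoS (n := n)) := by
  constructor
  · intro a b
    induction a using Quotient.inductionOn with
    | _ U =>
    induction b using Quotient.inductionOn with
    | _ V =>
    intro h
    exact QuotientGroup.eq.2 ((sqU_eq_iff U V).1 h)
  · intro A
    obtain ⟨U, h⟩ := sqU_surjective A
    exact ⟨QuotientGroup.mk U, h⟩

theorem exists_homeo :
    Nonempty ((Matrix.unitaryGroup (Fin n) ℂ ⧸ realOrthogonalSubgroup n) ≃ₜ SymU n) := by
  have := compact_unitary (n := n)
  have : CompactSpace (Matrix.unitaryGroup (Fin n) ℂ ⧸ realOrthogonalSubgroup n) :=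
    Quotient.compactSpace
  have hc : Continuous (quoS (n := n)) := Continuous.quotient_lift continuous_sqU _
  exact ⟨Continuous.homeoOfEquivCompactToT2 (f := Equiv.ofBijective _ quoS_bijective) hc⟩

theorem fg_mapOfEq_map {X Y : Type*} [TopologicalSpace X] [TopologicalSpace Y] (f : C(X, Y))
    (g : C(Y, X)) (hgf : ∀ x, g (f x) = x) (x : X) (p : FundamentalGroup X x) :
    FundamentalGroup.mapOfEq g (hgf x) (FundamentalGroup.map f x p) = p := by
  rw [FundamentalGroup.mapOfEq_apply]
  induction p using Quotient.inductionOn with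
  | _ p =>
  change Path.Homotopic.Quotient.mk
    (((p.map f.continuous).map g.continuous).cast (hgf x).symm (hgf x).symm) =
    Path.Homotopic.Quotient.mk p
  congr 1
  ext t
  exact hgf (p t)

theorem fg_map_mapOfEq {X Y : Type*} [TopologicalSpace X] [TopologicalSpace Y] (f : C(X, Y))
    (g : C(Y, X)) (hgf : ∀ x, g (f x) = x) (hfg : ∀ y, f (g y) = y) (x : X)
    (p : FundamentalGroup Y (f x)) :
    FundamentalGroup.map f x (FundamentalGroup.mapOfEq g (hgf x) p) = p := by
  rw [FundamentalGroup.mapOfEq_apply]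
  induction p using Quotient.inductionOn with
  | _ p =>
  change Path.Homotopic.Quotient.mk
    (((p.map g.continuous).cast (hgf x).symm (hgf x).symm).map f.continuous) =
    Path.Homotopic.Quotient.mk p
  congr 1
  ext t
  exact hfg (p t)

/-- A homeomorphism induces an isomorphism of fundamental groups. -/
theorem fg_equiv {X Y : Type*} [TopologicalSpace X] [TopologicalSpace Y] (h : X ≃ₜ Y) (x : X) :
    Nonempty (FundamentalGroup X x ≃* FundamentalGroup Y (h x)) := by
  let f : C(X, Y) := ⟨h, h.continuous⟩
  let g : C(Y, X) := ⟨h.symm, h.symm.continuous⟩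
  have hgf : ∀ x, g (f x) = x := h.symm_apply_apply
  have hfg : ∀ y, f (g y) = y := h.apply_symm_apply
  exact ⟨MulEquiv.ofBijective (FundamentalGroup.map f x)
    ⟨Function.LeftInverse.injective (fg_mapOfEq_map f g hgf x),
      Function.RightInverse.surjective (fg_map_mapOfEq f g hgf hfg x)⟩⟩

end Homeo

/-- The fundamental group of the Lagrangian Grassmannian
`L(n) ≅ U(n)/O(n)` is isomorphic to `ℤ`: the fundamental group of the coset space
`U(n)/O(n)` (with the quotient topology), where `O(n)` is the subgroup of unitary
matrices with real entries, is infinite cyclic. -/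
theorem fundamentalGroup_unitary_mod_orthogonal (n : ℕ) (hn : 1 ≤ n)
    (x : Matrix.unitaryGroup (Fin n) ℂ ⧸ realOrthogonalSubgroup n) :
    Nonempty (FundamentalGroup (Matrix.unitaryGroup (Fin n) ℂ ⧸ realOrthogonalSubgroup n) x
      ≃* Multiplicative ℤ) := by
  obtain ⟨h⟩ := exists_homeo (n := n)
  obtain ⟨e⟩ := pi1_symU (n := n) ⟨0, hn⟩
  have := pathConnected_symU (n := n)
  obtain ⟨e1⟩ := fg_equiv h x
  exact ⟨e1.trans ((FundamentalGroup.fundamentalGroupMulEquivOfPathConnected _ _).trans e.symm)⟩
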